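/- arXiv:hep-th/9404040 — 3 statements merged into one kernel-verified Lean document; each statement's English description precedes it below -/
import Mathlib

section
/- Suppose the N×N matrices L and F^{ab} (1 ≤ a,b ≤ r) over A satisfy, for some N²×N² matrix R over A: {L ⊗, L} = [R, L ⊗ 1] − [R^π, 1 ⊗ L], {L ⊗, F^{ab}} = −[R^π, 1 ⊗ F^{ab}], and {F^{ab} ⊗, F^{cd}} = (δ_{ad} F^{cb} ⊗ 1 − δ_{cb} 1 ⊗ F^{ad})·C. Define F^{ab}_{n,0} = Tr(L^n F^{ab}). Then the generators F^{ab}_{n,0} close an exact current algebra: for all n, m ≥ 0 and all a, b, c, d, {F^{ab}_{n,0}, F^{cd}_{m,0}} = δ_{ad} F^{cb}_{n+m,0} − δ_{cb} F^{ad}_{n+m,0}. -/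
open Matrix Kronecker

structure PoissonBr (A : Type*) [CommRing A] where
  br : A → A → A
  add_left : ∀ x y z, br (x + y) z = br x z + br y z
  add_right : ∀ x y z, br x (y + z) = br x y + br x z
  antisymm : ∀ x y, br x y = -br y x
  leibniz : ∀ x y z, br x (y * z) = br x y * z + y * br x z

/-- The matrix `{M ⊗, M'}` of pairwise brackets of entries. -/
def matBr {A : Type*} [CommRing A] {N : ℕ} (P : PoissonBr A)
    (M M' : Matrix (Fin N) (Fin N) A) :
    Matrix (Fin N × Fin N) (Fin N × Fin N) A :=
  fun p q => P.br (M p.1 q.1) (M' p.2 q.2)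

/-- `R^π`, the permuted matrix. -/
def piSwap {A : Type*} [CommRing A] {N : ℕ}
    (R : Matrix (Fin N × Fin N) (Fin N × Fin N) A) :
    Matrix (Fin N × Fin N) (Fin N × Fin N) A :=
  fun p q => R (p.2, p.1) (q.2, q.1)

/-- The Casimir matrix `C`, with entries `C_{(i,k),(j,l)} = δ_{il} δ_{kj}`. -/
def casC {A : Type*} [CommRing A] {N : ℕ} :
    Matrix (Fin N × Fin N) (Fin N × Fin N) A :=
  fun p q => if p.1 = q.2 ∧ p.2 = q.1 then 1 else 0

/-- Matrix commutator. -/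
def mComm {A : Type*} [CommRing A] {n : Type*} [Fintype n] (X Y : Matrix n n A) :
    Matrix n n A := X * Y - Y * X

section Commutator

variable {A n : Type*} [CommRing A] [Fintype n]

theorem mComm_mul_of_commute {Y G : Matrix n n A} (h : Commute G Y) (Q : Matrix n n A) :
    mComm Q Y * G = mComm (Q * G) Y := by
  simp only [mComm, sub_mul, Matrix.mul_assoc, h.eq]

theorem mul_mComm_of_commute {Y G : Matrix n n A} (h : Commute G Y) (Q : Matrix n n A) :
    G * mComm Q Y = mComm (G * Q) Y := by
  simp only [mComm, mul_sub, ← Matrix.mul_assoc, h.eq]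

theorem mComm_mul (R X Y : Matrix n n A) :
    mComm R (X * Y) = mComm R X * Y + X * mComm R Y := by
  simp only [mComm, sub_mul, mul_sub, Matrix.mul_assoc]
  abel

theorem mComm_add_left (Q S Y : Matrix n n A) : mComm (Q + S) Y = mComm Q Y + mComm S Y := by
  simp only [mComm, add_mul, mul_add]
  abel

theorem mComm_zero_left (Y : Matrix n n A) : mComm 0 Y = 0 := by
  simp [mComm]

theorem mComm_one_right [DecidableEq n] (Q : Matrix n n A) : mComm Q 1 = 0 := by
  simp [mComm]

theorem trace_mComm (X Y : Matrix n n A) : (mComm X Y).trace = 0 := by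
  rw [mComm, trace_sub, trace_mul_comm, sub_self]

end Commutator

namespace PoissonBr

variable {A : Type*} [CommRing A] (P : PoissonBr A)

theorem br_zero_right (x : A) : P.br x 0 = 0 := by
  simpa using P.add_right x 0 0

theorem br_zero_left (x : A) : P.br 0 x = 0 := by
  simpa using P.add_left 0 0 x

theorem br_one_right (x : A) : P.br x 1 = 0 := by
  simpa using P.leibniz x 1 1

theorem br_one_left (x : A) : P.br 1 x = 0 := by
  rw [P.antisymm, P.br_one_right, neg_zero]

theorem leibniz_left (x y z : A) : P.br (x * y) z = P.br x z * y + x * P.br y z := by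
  rw [P.antisymm, P.leibniz, P.antisymm x z, P.antisymm y z]
  ring

theorem br_sum_right {ι : Type*} (s : Finset ι) (x : A) (f : ι → A) :
    P.br x (∑ i ∈ s, f i) = ∑ i ∈ s, P.br x (f i) :=
  map_sum (AddMonoidHom.mk' (P.br x) (P.add_right x)) f s

theorem br_sum_left {ι : Type*} (s : Finset ι) (f : ι → A) (x : A) :
    P.br (∑ i ∈ s, f i) x = ∑ i ∈ s, P.br (f i) x :=
  map_sum (AddMonoidHom.mk' (P.br · x) fun y z => P.add_left y z x) f s

end PoissonBr

section MatrixBracket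

variable {A : Type*} [CommRing A] {N : ℕ} (P : PoissonBr A)

theorem kronecker_one_commute (X Y : Matrix (Fin N) (Fin N) A) :
    Commute (X ⊗ₖ (1 : Matrix (Fin N) (Fin N) A)) ((1 : Matrix (Fin N) (Fin N) A) ⊗ₖ Y) := by
  simp [Commute, SemiconjBy, ← mul_kronecker_mul]

theorem mul_kronecker_one (X Y : Matrix (Fin N) (Fin N) A) :
    (X * Y) ⊗ₖ (1 : Matrix (Fin N) (Fin N) A) = (X ⊗ₖ 1) * (Y ⊗ₖ 1) := by
  simp [← mul_kronecker_mul]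

theorem one_kronecker_mul (X Y : Matrix (Fin N) (Fin N) A) :
    (1 : Matrix (Fin N) (Fin N) A) ⊗ₖ (X * Y) = (1 ⊗ₖ X) * (1 ⊗ₖ Y) := by
  simp [← mul_kronecker_mul]

theorem matBr_mul_right (M X Y : Matrix (Fin N) (Fin N) A) :
    matBr P M (X * Y) = matBr P M X * (1 ⊗ₖ Y) + (1 ⊗ₖ X) * matBr P M Y := by
  ext p q
  simp [matBr, Matrix.mul_apply, P.br_sum_right, P.leibniz, Fintype.sum_prod_type,
    Matrix.one_apply, Finset.sum_add_distrib]

theorem matBr_mul_left (X Y M : Matrix (Fin N) (Fin N) A) :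
    matBr P (X * Y) M = matBr P X M * (Y ⊗ₖ 1) + (X ⊗ₖ 1) * matBr P Y M := by
  ext p q
  simp [matBr, Matrix.mul_apply, P.br_sum_left, P.leibniz_left, Fintype.sum_prod_type,
    Matrix.one_apply, Finset.sum_add_distrib]

theorem matBr_one_left (M : Matrix (Fin N) (Fin N) A) : matBr P 1 M = 0 := by
  ext p q
  simp only [matBr, Matrix.one_apply, Matrix.zero_apply]
  split_ifs <;> simp [P.br_one_left, P.br_zero_left]

theorem matBr_one_right (M : Matrix (Fin N) (Fin N) A) : matBr P M 1 = 0 := by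
  ext p q
  simp only [matBr, Matrix.one_apply, Matrix.zero_apply]
  split_ifs <;> simp [P.br_one_right, P.br_zero_right]

theorem trace_matBr (X Y : Matrix (Fin N) (Fin N) A) :
    (matBr P X Y).trace = P.br X.trace Y.trace := by
  simp [Matrix.trace, matBr, P.br_sum_left, P.br_sum_right, Fintype.sum_prod_type]

theorem matBr_eq_neg_piSwap (X Y : Matrix (Fin N) (Fin N) A) :
    matBr P X Y = -piSwap (matBr P Y X) := by
  ext p q
  exact P.antisymm _ _

theorem piSwap_mul (X Y : Matrix (Fin N × Fin N) (Fin N × Fin N) A) :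
    piSwap (X * Y) = piSwap X * piSwap Y := by
  ext p q
  exact Fintype.sum_equiv (Equiv.prodComm _ _) _ _ fun _ => rfl

theorem piSwap_one_kronecker (X : Matrix (Fin N) (Fin N) A) :
    piSwap ((1 : Matrix (Fin N) (Fin N) A) ⊗ₖ X) = X ⊗ₖ 1 := by
  ext p q
  exact mul_comm _ _

theorem piSwap_mComm (X Y : Matrix (Fin N × Fin N) (Fin N × Fin N) A) :
    piSwap (mComm X Y) = mComm (piSwap X) (piSwap Y) := by
  rw [mComm, mComm, ← piSwap_mul, ← piSwap_mul]
  rfl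

theorem trace_kronecker_mul_casC (X Y : Matrix (Fin N) (Fin N) A) :
    ((X ⊗ₖ Y) * casC).trace = (X * Y).trace := by
  simp [Matrix.trace, Matrix.mul_apply, casC, Fintype.sum_prod_type, ite_and]

variable {P} {L : Matrix (Fin N) (Fin N) A} {R : Matrix (Fin N × Fin N) (Fin N × Fin N) A}

/-- If `{L ⊗, ·}` acts by the commutators with `R` and `R^π`, then so does `{L ^ n ⊗, ·}`, with
`R^π` replaced by some matrix `Q`. -/
theorem exists_matBr_pow_left {ι : Type*} {F : ι → Matrix (Fin N) (Fin N) A}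
    (hLL : matBr P L L = mComm R (L ⊗ₖ 1) - mComm (piSwap R) (1 ⊗ₖ L))
    (hLF : ∀ i, matBr P L (F i) = -mComm (piSwap R) (1 ⊗ₖ F i)) (n : ℕ) :
    ∃ Q, matBr P (L ^ n) L = mComm R ((L ^ n) ⊗ₖ 1) - mComm Q (1 ⊗ₖ L) ∧
      ∀ i, matBr P (L ^ n) (F i) = -mComm Q (1 ⊗ₖ F i) := by
  induction n with
  | zero =>
    exact ⟨0, by simp [matBr_one_left, mComm_zero_left, mComm_one_right],
      fun i => by simp [matBr_one_left, mComm_zero_left]⟩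
  | succ n ih =>
    obtain ⟨Q, hQL, hQF⟩ := ih
    refine ⟨Q * (L ⊗ₖ 1) + ((L ^ n) ⊗ₖ 1) * piSwap R, ?_, fun i => ?_⟩
    · rw [pow_succ, matBr_mul_left, hQL, hLL, mul_kronecker_one, mComm_mul, mComm_add_left,
        ← mComm_mul_of_commute (kronecker_one_commute _ _),
        ← mul_mComm_of_commute (kronecker_one_commute _ _), sub_mul, mul_sub]
      abel
    · rw [pow_succ, matBr_mul_left, hQF, hLF, mComm_add_left,
        ← mComm_mul_of_commute (kronecker_one_commute _ _),
        ← mul_mComm_of_commute (kronecker_one_commute _ _), neg_mul, mul_neg]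
      abel

theorem exists_matBr_pow_right {X : Matrix (Fin N) (Fin N) A}
    {Q : Matrix (Fin N × Fin N) (Fin N × Fin N) A}
    (h : matBr P X L = mComm R (X ⊗ₖ 1) - mComm Q (1 ⊗ₖ L)) (m : ℕ) :
    ∃ S, matBr P X (L ^ m) = mComm S (X ⊗ₖ 1) - mComm Q (1 ⊗ₖ (L ^ m)) := by
  induction m with
  | zero => exact ⟨0, by simp [matBr_one_right, mComm_zero_left, mComm_one_right]⟩
  | succ m ih =>
    obtain ⟨S, hS⟩ := ih
    refine ⟨S * (1 ⊗ₖ L) + (1 ⊗ₖ (L ^ m)) * R, ?_⟩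
    rw [pow_succ, matBr_mul_right, hS, h, one_kronecker_mul, mComm_mul, mComm_add_left,
      ← mComm_mul_of_commute (kronecker_one_commute _ _).symm,
      ← mul_mComm_of_commute (kronecker_one_commute _ _).symm, sub_mul, mul_sub]
    abel

/-- The bracket of the traces of `L ^ n * G` and `L ^ m * H` does not involve `R`. -/
theorem br_trace_pow_mul {G H : Matrix (Fin N) (Fin N) A}
    (hLL : matBr P L L = mComm R (L ⊗ₖ 1) - mComm (piSwap R) (1 ⊗ₖ L))
    (hLG : matBr P L G = -mComm (piSwap R) (1 ⊗ₖ G))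
    (hLH : matBr P L H = -mComm (piSwap R) (1 ⊗ₖ H)) (n m : ℕ) :
    P.br (L ^ n * G).trace (L ^ m * H).trace = (((L ^ n) ⊗ₖ (L ^ m)) * matBr P G H).trace := by
  have hGL : matBr P G L = mComm R (G ⊗ₖ 1) := by
    have hneg (Z : Matrix (Fin N × Fin N) (Fin N × Fin N) A) : piSwap (-Z) = -piSwap Z := rfl
    rw [matBr_eq_neg_piSwap, hLG, hneg, neg_neg, piSwap_mComm, piSwap_one_kronecker]
    rfl
  obtain ⟨Q, hQL, hQH⟩ := exists_matBr_pow_left (F := fun _ : Unit => H) hLL (fun _ => hLH) n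
  have hXL : matBr P (L ^ n * G) L =
      mComm R ((L ^ n * G) ⊗ₖ 1) - mComm (Q * (G ⊗ₖ 1)) (1 ⊗ₖ L) := by
    rw [matBr_mul_left, hQL, hGL, mul_kronecker_one, mComm_mul,
      ← mComm_mul_of_commute (kronecker_one_commute _ _), sub_mul]
    abel
  obtain ⟨S, hS⟩ := exists_matBr_pow_right hXL m
  have key : matBr P (L ^ n * G) (L ^ m * H) =
      mComm (S * (1 ⊗ₖ H)) ((L ^ n * G) ⊗ₖ 1) - mComm (Q * (G ⊗ₖ 1)) (1 ⊗ₖ (L ^ m * H)) +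
        ((L ^ n) ⊗ₖ (L ^ m)) * matBr P G H := by
    have hLL' : (L ^ n) ⊗ₖ (L ^ m) = (1 ⊗ₖ (L ^ m)) * ((L ^ n) ⊗ₖ 1) := by
      simp [← mul_kronecker_mul]
    rw [matBr_mul_right, hS, matBr_mul_left, hQH (), one_kronecker_mul, mComm_mul,
      ← mComm_mul_of_commute (kronecker_one_commute _ _).symm, neg_mul,
      mComm_mul_of_commute (kronecker_one_commute _ _), sub_mul, mul_add, mul_neg, hLL',
      Matrix.mul_assoc (1 ⊗ₖ (L ^ m))]
    abel
  rw [← trace_matBr, key, trace_add, trace_sub, trace_mComm, trace_mComm, sub_zero, zero_add]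

end MatrixBracket

theorem statement11 {A : Type*} [CommRing A] {N : ℕ} (P : PoissonBr A)
    {r : ℕ} (hr : 1 ≤ r) (L : Matrix (Fin N) (Fin N) A)
    (F : Fin r → Fin r → Matrix (Fin N) (Fin N) A)
    (R : Matrix (Fin N × Fin N) (Fin N × Fin N) A)
    (hLL : matBr P L L =
      mComm R (L ⊗ₖ (1 : Matrix (Fin N) (Fin N) A)) -
        mComm (piSwap R) ((1 : Matrix (Fin N) (Fin N) A) ⊗ₖ L))
    (hLF : ∀ a b, matBr P L (F a b) =
      -mComm (piSwap R) ((1 : Matrix (Fin N) (Fin N) A) ⊗ₖ F a b))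
    (hFF : ∀ a b c d, matBr P (F a b) (F c d) =
      ((if a = d then (1 : A) else 0) • ((F c b) ⊗ₖ (1 : Matrix (Fin N) (Fin N) A)) -
        (if c = b then (1 : A) else 0) • ((1 : Matrix (Fin N) (Fin N) A) ⊗ₖ F a d)) *
        casC) :
    ∀ (n m : ℕ) (a b c d : Fin r),
      P.br ((L ^ n * F a b).trace) ((L ^ m * F c d).trace) =
        (if a = d then (1 : A) else 0) * (L ^ (n + m) * F c b).trace -
          (if c = b then (1 : A) else 0) * (L ^ (n + m) * F a d).trace := by
  intro n m a b c d
  rw [br_trace_pow_mul hLL (hLF a b) (hLF c d), hFF, ← Matrix.mul_assoc, mul_sub, sub_mul,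
    trace_sub, Matrix.mul_smul, Matrix.mul_smul, Matrix.smul_mul, Matrix.smul_mul, trace_smul,
    trace_smul, ← mul_kronecker_mul, ← mul_kronecker_mul, Matrix.mul_one, Matrix.mul_one,
    trace_kronecker_mul_casC, trace_kronecker_mul_casC, trace_mul_comm (L ^ n * F c b),
    ← Matrix.mul_assoc, ← Matrix.mul_assoc, ← pow_add, ← pow_add, add_comm m n, smul_eq_mul,
    smul_eq_mul]
end

section
/- Suppose the N×N matrices L, Q and F^{ab} (1 ≤ a,b ≤ r) over A satisfy, for some N²×N² matrix R over A: {L ⊗, L} = [R, L ⊗ 1] − [R^π, 1 ⊗ L], {L ⊗, Q} = −[R^π, 1 ⊗ Q] + C, {L ⊗, F^{ab}} = −[R^π, 1 ⊗ F^{ab}], {Q ⊗, Q} = 0, and {Q ⊗, F^{ab}} = 0. Define W_n^1 = Tr(L^n Q) and F^{ab}_{m,0} = Tr(L^m F^{ab}). Then the Virasoro generators act exactly on the current algebra generators: for all n ≥ 0, m ≥ 1, {W_n^1, F^{ab}_{m,0}} = −m F^{ab}_{n+m−1,0}. -/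
open Matrix Kronecker

/-- The Hamiltonian derivation `{x, ·}`. -/
def PoissonBr.ad {A : Type*} [CommRing A] (P : PoissonBr A) (x : A) : Derivation ℤ A A :=
  Derivation.mk' (AddMonoidHom.mk' (P.br x) (P.add_right x)).toIntLinearMap fun y z => by
    simp [P.leibniz, mul_comm, add_comm]

@[simp]
theorem PoissonBr.ad_apply {A : Type*} [CommRing A] (P : PoissonBr A) (x y : A) :
    P.ad x y = P.br x y := rfl

theorem Derivation.map_matrix_mul {A n : Type*} [CommRing A] [Fintype n] (d : Derivation ℤ A A)
    (X Y : Matrix n n A) : (X * Y).map d = X.map d * Y + X * Y.map d := by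
  ext i j
  simp [Matrix.mul_apply, ← Finset.sum_add_distrib, mul_comm, add_comm]

section PowGrad

variable {A n : Type*} [CommRing A] [Fintype n] [DecidableEq n]

/-- The gradient `∑ s < m, L ^ (m - 1 - s) * X * L ^ s` of `Tr (L ^ m * X)` with respect to `L`. -/
def powGrad (L : Matrix n n A) : ℕ → Matrix n n A → Matrix n n A
  | 0, _ => 0
  | m + 1, X => powGrad L m (L * X) + X * L ^ m

theorem Derivation.map_trace_pow_mul (d : Derivation ℤ A A) (L : Matrix n n A) (m : ℕ)
    (X : Matrix n n A) :
    d (L ^ m * X).trace = (L.map d * powGrad L m X).trace + (X.map d * L ^ m).trace := by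
  induction m generalizing X with
  | zero => simp [powGrad, Matrix.trace]
  | succ m ih =>
    rw [pow_succ, Matrix.mul_assoc, ih, d.map_matrix_mul, powGrad, ← pow_succ, pow_succ',
      Matrix.add_mul, Matrix.mul_add, Matrix.trace_add, Matrix.trace_add, Matrix.mul_assoc L,
      Matrix.trace_mul_comm L, Matrix.mul_assoc, Matrix.mul_assoc, ← pow_succ, ← pow_succ']
    abel

theorem mul_powGrad_sub_powGrad_mul (L : Matrix n n A) (m : ℕ) (X : Matrix n n A) :
    L * powGrad L m X - powGrad L m X * L = L ^ m * X - X * L ^ m := by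
  induction m generalizing X with
  | zero => simp [powGrad]
  | succ m ih =>
    have h := ih (L * X)
    rw [sub_eq_iff_eq_add] at h
    rw [powGrad, Matrix.mul_add, h, pow_succ]
    noncomm_ring

theorem trace_powGrad_mul_pow (L : Matrix n n A) (k m : ℕ) (X : Matrix n n A) :
    (powGrad L m X * L ^ k).trace = m • (L ^ (k + m - 1) * X).trace := by
  induction m generalizing X with
  | zero => simp [powGrad]
  | succ m ih =>
    rw [powGrad, Matrix.add_mul, Matrix.trace_add, ih, succ_nsmul, Matrix.mul_assoc, ← pow_add,
      Matrix.trace_mul_comm X, add_comm m k, ← Nat.add_assoc, Nat.add_sub_cancel]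
    rcases m with _ | m
    · simp
    · rw [← Matrix.mul_assoc, ← pow_succ, ← Nat.add_assoc, Nat.add_sub_cancel]

end PowGrad

section PartialTrace

variable {A : Type*} [CommRing A] {N : ℕ}

/-- The partial trace `Tr₂ (T * (1 ⊗ X))` over the second tensor factor. -/
def partialTrace (T : Matrix (Fin N × Fin N) (Fin N × Fin N) A) (X : Matrix (Fin N) (Fin N) A) :
    Matrix (Fin N) (Fin N) A :=
  fun i j => ∑ k, ∑ l, T (i, k) (j, l) * X l k

theorem partialTrace_add (S T : Matrix (Fin N × Fin N) (Fin N × Fin N) A)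
    (X : Matrix (Fin N) (Fin N) A) :
    partialTrace (S + T) X = partialTrace S X + partialTrace T X := by
  ext i j
  simp [partialTrace, add_mul, Finset.sum_add_distrib]

theorem partialTrace_neg (T : Matrix (Fin N × Fin N) (Fin N × Fin N) A)
    (X : Matrix (Fin N) (Fin N) A) : partialTrace (-T) X = -partialTrace T X := by
  ext i j
  simp [partialTrace]

theorem partialTrace_sub (S T : Matrix (Fin N × Fin N) (Fin N × Fin N) A)
    (X : Matrix (Fin N) (Fin N) A) :
    partialTrace (S - T) X = partialTrace S X - partialTrace T X := by
  rw [sub_eq_add_neg, partialTrace_add, partialTrace_neg, sub_eq_add_neg]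

theorem partialTrace_sub_right (T : Matrix (Fin N × Fin N) (Fin N × Fin N) A)
    (X Y : Matrix (Fin N) (Fin N) A) :
    partialTrace T (X - Y) = partialTrace T X - partialTrace T Y := by
  ext i j
  simp [partialTrace, mul_sub]

theorem partialTrace_casC (X : Matrix (Fin N) (Fin N) A) : partialTrace casC X = X := by
  ext i j
  simp [partialTrace, casC, ite_and]

theorem partialTrace_mComm_left (T : Matrix (Fin N × Fin N) (Fin N × Fin N) A)
    (X Y : Matrix (Fin N) (Fin N) A) :
    partialTrace (mComm T (Y ⊗ₖ (1 : Matrix (Fin N) (Fin N) A))) X =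
      partialTrace T X * Y - Y * partialTrace T X := by
  ext i j
  simp only [partialTrace, mComm, Matrix.sub_apply, Matrix.mul_apply, Fintype.sum_prod_type,
    kroneckerMap_apply, Matrix.one_apply, mul_ite, ite_mul, mul_one, mul_zero, zero_mul,
    Finset.sum_ite_eq, Finset.sum_ite_eq', Finset.mem_univ, if_true, sub_mul,
    Finset.sum_sub_distrib, Finset.sum_mul, Finset.mul_sum]
  congr 1
  · rw [Finset.sum_comm_cycle]
    refine Finset.sum_congr rfl fun p _ => Finset.sum_congr rfl fun k _ =>
      Finset.sum_congr rfl fun l _ => ?_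
    ring
  · rw [Finset.sum_comm_cycle]
    refine Finset.sum_congr rfl fun p _ => Finset.sum_congr rfl fun k _ =>
      Finset.sum_congr rfl fun l _ => ?_
    ring

theorem partialTrace_mComm_right (T : Matrix (Fin N × Fin N) (Fin N × Fin N) A)
    (X Y : Matrix (Fin N) (Fin N) A) :
    partialTrace (mComm T ((1 : Matrix (Fin N) (Fin N) A) ⊗ₖ Y)) X =
      partialTrace T (Y * X - X * Y) := by
  rw [partialTrace_sub_right]
  ext i j
  have aux (g : Fin N → Fin N → A) (q : Fin N) :
      ∑ x, ∑ y, (if q = x then g x y else 0) = ∑ y, g q y := by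
    rw [Finset.sum_comm]; simp
  have aux' (g : Fin N → Fin N → A) (q : Fin N) :
      ∑ x, ∑ y, (if x = q then g x y else 0) = ∑ y, g q y := by
    rw [Finset.sum_comm]; simp
  simp only [partialTrace, mComm, Matrix.sub_apply, Matrix.mul_apply, Fintype.sum_prod_type,
    kroneckerMap_apply, Matrix.one_apply, mul_ite, ite_mul, one_mul, mul_zero, zero_mul,
    aux, aux', sub_mul, Finset.sum_sub_distrib, Finset.sum_mul, Finset.mul_sum]
  congr 1
  · refine Finset.sum_congr rfl fun k _ => ?_
    rw [Finset.sum_comm]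
    refine Finset.sum_congr rfl fun p _ => Finset.sum_congr rfl fun l _ => ?_
    ring
  · rw [Finset.sum_comm_cycle]
    refine Finset.sum_congr rfl fun p _ => ?_
    rw [Finset.sum_comm]
    refine Finset.sum_congr rfl fun l _ => Finset.sum_congr rfl fun k _ => ?_
    ring

theorem map_ad_trace_pow_mul (P : PoissonBr A) (L X M : Matrix (Fin N) (Fin N) A) (m : ℕ) :
    M.map (P.ad (L ^ m * X).trace) =
      -(partialTrace (matBr P M L) (powGrad L m X) + partialTrace (matBr P M X) (L ^ m)) := by
  ext i j
  rw [Matrix.map_apply, P.ad_apply, P.antisymm, ← P.ad_apply, Derivation.map_trace_pow_mul]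
  rfl

theorem matBr_symm (P : PoissonBr A) (M M' : Matrix (Fin N) (Fin N) A) :
    matBr P M M' = -piSwap (matBr P M' M) := by
  ext p q
  exact P.antisymm _ _

theorem piSwap_mComm_one_kronecker (R : Matrix (Fin N × Fin N) (Fin N × Fin N) A)
    (X : Matrix (Fin N) (Fin N) A) :
    piSwap (mComm (piSwap R) ((1 : Matrix (Fin N) (Fin N) A) ⊗ₖ X)) =
      mComm R (X ⊗ₖ (1 : Matrix (Fin N) (Fin N) A)) := by
  ext ⟨i, k⟩ ⟨j, l⟩
  simp only [piSwap, mComm, Matrix.sub_apply, Matrix.mul_apply, Fintype.sum_prod_type,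
    kroneckerMap_apply, mul_comm (X _ _)]
  congr 1 <;> exact Finset.sum_comm

theorem matBr_eq_of_matBr_eq_add_casC (P : PoissonBr A) {L Q : Matrix (Fin N) (Fin N) A}
    {R : Matrix (Fin N × Fin N) (Fin N × Fin N) A}
    (h : matBr P L Q = -mComm (piSwap R) ((1 : Matrix (Fin N) (Fin N) A) ⊗ₖ Q) + casC) :
    matBr P Q L = mComm R (Q ⊗ₖ (1 : Matrix (Fin N) (Fin N) A)) - casC := by
  rw [matBr_symm, h, ← piSwap_mComm_one_kronecker]
  ext p q
  simp [piSwap, casC, and_comm, sub_eq_add_neg, add_comm]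

end PartialTrace

theorem statement12 {A : Type*} [CommRing A] {N : ℕ} (P : PoissonBr A)
    {r : ℕ} (hr : 1 ≤ r) (L Q : Matrix (Fin N) (Fin N) A)
    (F : Fin r → Fin r → Matrix (Fin N) (Fin N) A)
    (R : Matrix (Fin N × Fin N) (Fin N × Fin N) A)
    (hLL : matBr P L L =
      mComm R (L ⊗ₖ (1 : Matrix (Fin N) (Fin N) A)) -
        mComm (piSwap R) ((1 : Matrix (Fin N) (Fin N) A) ⊗ₖ L))
    (hLQ : matBr P L Q =
      -mComm (piSwap R) ((1 : Matrix (Fin N) (Fin N) A) ⊗ₖ Q) + casC)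
    (hLF : ∀ a b, matBr P L (F a b) =
      -mComm (piSwap R) ((1 : Matrix (Fin N) (Fin N) A) ⊗ₖ F a b))
    (hQQ : matBr P Q Q = 0)
    (hQF : ∀ a b, matBr P Q (F a b) = 0) :
    ∀ (n m : ℕ), 1 ≤ m → ∀ (a b : Fin r),
      P.br ((L ^ n * Q).trace) ((L ^ m * F a b).trace) =
        -(m • ((L ^ (n + m - 1) * F a b).trace)) := by
  intro n m _ a b
  set ρ := partialTrace R (powGrad L m (F a b)) with hρ
  have hL : L.map (P.ad (L ^ m * F a b).trace) = L * ρ - ρ * L := by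
    rw [map_ad_trace_pow_mul, hLL, hLF, partialTrace_sub, partialTrace_neg,
      partialTrace_mComm_left, partialTrace_mComm_right, partialTrace_mComm_right,
      mul_powGrad_sub_powGrad_mul, partialTrace_sub_right, partialTrace_sub_right, ← hρ]
    abel
  have hQ : Q.map (P.ad (L ^ m * F a b).trace) = Q * ρ - ρ * Q + powGrad L m (F a b) := by
    have h0 : partialTrace (0 : Matrix (Fin N × Fin N) (Fin N × Fin N) A) (L ^ m) = 0 := by
      ext i j
      simp [partialTrace]
    rw [map_ad_trace_pow_mul, matBr_eq_of_matBr_eq_add_casC P hLQ, hQF, h0, partialTrace_sub,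
      partialTrace_mComm_left, partialTrace_casC, ← hρ]
    abel
  have cyc (X Y : Matrix (Fin N) (Fin N) A) :
      ((X * ρ - ρ * X) * Y).trace = (ρ * (Y * X - X * Y)).trace := by
    rw [Matrix.sub_mul, Matrix.mul_sub, Matrix.trace_sub, Matrix.trace_sub, Matrix.mul_assoc,
      Matrix.trace_mul_comm X, Matrix.mul_assoc, Matrix.mul_assoc]
  have key : (ρ * (powGrad L n Q * L - L * powGrad L n Q)).trace +
      (ρ * (L ^ n * Q - Q * L ^ n)).trace = 0 := by
    rw [← Matrix.trace_add, ← Matrix.mul_add, ← mul_powGrad_sub_powGrad_mul]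
    simp
  rw [P.antisymm, ← P.ad_apply, Derivation.map_trace_pow_mul, hL, hQ, Matrix.add_mul,
    Matrix.trace_add, cyc, cyc, ← add_assoc, key, zero_add, trace_powGrad_mul_pow]
end

section
/- For every l ≥ 0, every word (B_1, …, B_l) with each B_k ∈ {L, K, K^{−1}}, and every choice of N, r ≥ 1 and 1 ≤ a, b ≤ r, there exist polynomials P and P^{ab} with integer coefficients in the variables X_α, X_{p,q} (0 ≤ p ≤ l, q ∈ ℤ with |q| ≤ l) and Y^{cd}_{p,q} (1 ≤ c, d ≤ r, 0 ≤ p ≤ l, |q| ≤ l), such that: for every commutative ring A, every α ∈ A, all ξ_i^a, η_i^a ∈ A, every invertible N×N matrix K over A, and every N×N matrix L over A satisfying [L, K] = 2FK − 2αK, one has Tr(B_1 ⋯ B_l) = P and Tr(B_1 ⋯ B_l F^{ab}) = P^{ab}, where X_α is evaluated at α, X_{p,q} at the normal-ordered generator Tr(L^p K^q), and Y^{cd}_{p,q} at Tr(L^p K^q F^{cd}) (here K^q for negative q means the corresponding power of K^{−1}). -/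
open Matrix

/-- The rank-one matrices `F^{ab}` with entries `(F^{ab})_{ij} = ξ_i^b η_j^a`. -/
def Fab {A : Type*} [CommRing A] {N r : ℕ} (ξ η : Fin N → Fin r → A)
    (a b : Fin r) : Matrix (Fin N) (Fin N) A :=
  Matrix.of fun i j => ξ i b * η j a

/-- `F = Σ_a F^{aa}`. -/
def Fmat {A : Type*} [CommRing A] {N r : ℕ} (ξ η : Fin N → Fin r → A) :
    Matrix (Fin N) (Fin N) A :=
  ∑ a, Fab ξ η a a

/-- Variables: `X_α`, `X_{p,q}` (`p ≤ l`, `|q| ≤ l`), `Y^{cd}_{p,q}` (`p ≤ l`, `|q| ≤ l`). -/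
def TrigVars (r l : ℕ) : Type :=
  Unit ⊕ {pq : ℕ × ℤ // pq.1 ≤ l ∧ pq.2.natAbs ≤ l} ⊕
    ((Fin r × Fin r) × {pq : ℕ × ℤ // pq.1 ≤ l ∧ pq.2.natAbs ≤ l})

/-- A solution `(α, ξ, η, K, L)` of `[L, K] = 2FK - 2αK` with `K` invertible, over some ring. -/
structure LaxSolution (N r : ℕ) where
  A : Type
  [commRing : CommRing A]
  α : A
  ξ : Fin N → Fin r → A
  η : Fin N → Fin r → A
  K : Matrix (Fin N) (Fin N) A
  L : Matrix (Fin N) (Fin N) A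
  isUnit_K : IsUnit K
  comm : L * K - K * L = (2 : A) • (Fmat ξ η * K) - (2 * α) • K

attribute [instance] LaxSolution.commRing

theorem Fab_eq_vecMulVec {A : Type*} [CommRing A] {N r : ℕ} (ξ η : Fin N → Fin r → A)
    (a b : Fin r) : Fab ξ η a b = vecMulVec (fun i => ξ i b) (fun j => η j a) := rfl

theorem trace_mul_Fab {A : Type*} [CommRing A] {N r : ℕ} (ξ η : Fin N → Fin r → A)
    (U : Matrix (Fin N) (Fin N) A) (a b : Fin r) :
    (U * Fab ξ η a b).trace = (U *ᵥ fun i => ξ i b) ⬝ᵥ fun j => η j a := by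
  rw [Fab_eq_vecMulVec, mul_vecMulVec, trace_vecMulVec]

theorem trace_mul_Fab_mul_mul_Fab {A : Type*} [CommRing A] {N r : ℕ}
    (ξ η : Fin N → Fin r → A) (U V : Matrix (Fin N) (Fin N) A) (a b c d : Fin r) :
    (U * Fab ξ η a b * V * Fab ξ η c d).trace =
      (V * Fab ξ η a d).trace * (U * Fab ξ η c b).trace := by
  simp only [trace_mul_Fab]
  rw [Fab_eq_vecMulVec, mul_vecMulVec, vecMulVec_mul, vecMulVec_mulVec, ← dotProduct_mulVec]
  simp [dotProduct_comm]

namespace LaxSolution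

variable {N r : ℕ}

theorem isUnit_det_K (d : LaxSolution N r) : IsUnit d.K.det :=
  (isUnit_iff_isUnit_det _).1 d.isUnit_K

theorem K_mul_L (d : LaxSolution N r) :
    d.K * d.L = d.L * d.K + (-2 : d.A) • (Fmat d.ξ d.η * d.K) + (2 * d.α) • d.K := by
  have h := d.comm
  rw [sub_eq_iff_eq_add] at h
  rw [h, neg_smul]
  abel

theorem inv_K_mul_L (d : LaxSolution N r) :
    d.K⁻¹ * d.L =
      d.L * d.K⁻¹ + (2 : d.A) • (d.K⁻¹ * Fmat d.ξ d.η) + (-(2 * d.α)) • d.K⁻¹ := by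
  have h := congrArg (fun M => d.K⁻¹ * M * d.K⁻¹) d.comm
  simp only [mul_sub, sub_mul, Matrix.mul_smul, Matrix.smul_mul, Matrix.mul_assoc,
    mul_nonsing_inv _ d.isUnit_det_K, Matrix.mul_one] at h
  rw [nonsing_inv_mul_cancel_left _ _ d.isUnit_det_K, sub_eq_iff_eq_add] at h
  rw [h, neg_smul]
  abel

/-- The matrix encoded by a letter: `0 ↦ L`, `1 ↦ K`, `2 ↦ K⁻¹`. -/
noncomputable def letter (d : LaxSolution N r) (k : Fin 3) : Matrix (Fin N) (Fin N) d.A :=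
  if k = 0 then d.L else if k = 1 then d.K else d.K⁻¹

/-- The product of the letters of a word. -/
noncomputable def word (d : LaxSolution N r) (w : List (Fin 3)) : Matrix (Fin N) (Fin N) d.A :=
  (w.map d.letter).prod

theorem word_append (d : LaxSolution N r) (u v : List (Fin 3)) :
    d.word (u ++ v) = d.word u * d.word v := by
  simp [word]

theorem word_cons (d : LaxSolution N r) (k : Fin 3) (v : List (Fin 3)) :
    d.word (k :: v) = d.letter k * d.word v := by
  simp [word]

theorem word_replicate_zero (d : LaxSolution N r) (p : ℕ) :
    d.word (List.replicate p 0) = d.L ^ p := by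
  simp [word, letter]

theorem exists_word_eq_zpow (u : List (Fin 3)) (hu : 0 ∉ u) :
    ∃ q : ℤ, q.natAbs ≤ u.length ∧ ∀ d : LaxSolution N r, d.word u = d.K ^ q := by
  induction u with
  | nil => exact ⟨0, by simp, fun d => by simp [word]⟩
  | cons k u ih =>
    obtain ⟨hk, hu⟩ : 0 ≠ k ∧ 0 ∉ u := by simpa using hu
    obtain ⟨q, hq, h⟩ := ih hu
    by_cases h1 : k = 1
    · refine ⟨1 + q, by simp only [List.length_cons]; omega, fun d => ?_⟩
      rw [word_cons, h, Matrix.zpow_add d.isUnit_det_K, zpow_one]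
      simp [letter, h1]
    · refine ⟨-1 + q, by simp only [List.length_cons]; omega, fun d => ?_⟩
      rw [word_cons, h, Matrix.zpow_add d.isUnit_det_K, Matrix.zpow_neg_one]
      simp [letter, h1, hk.symm]

/-- The normal-ordered generators, as functions on the family of all solutions. -/
noncomputable def generator (N r l : ℕ) (v : TrigVars r l) (d : LaxSolution N r) : d.A :=
  match v with
  | Sum.inl _ => d.α
  | Sum.inr (Sum.inl pq) => (d.L ^ pq.1.1 * d.K ^ pq.1.2).trace
  | Sum.inr (Sum.inr cdpq) =>
      (d.L ^ cdpq.2.1.1 * d.K ^ cdpq.2.1.2 * Fab d.ξ d.η cdpq.1.1 cdpq.1.2).trace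

/-- The functions on the family of all solutions that are integer polynomials in the
normal-ordered generators. -/
noncomputable def polys (N r l : ℕ) : Subalgebra ℤ (∀ d : LaxSolution N r, d.A) :=
  (MvPolynomial.aeval (generator N r l)).range

theorem generator_mem_polys {l : ℕ} (v : TrigVars r l) : generator N r l v ∈ polys N r l :=
  ⟨MvPolynomial.X v, by simp⟩

theorem exists_of_mem_polys {l : ℕ} {f : ∀ d : LaxSolution N r, d.A} (hf : f ∈ polys N r l) :
    ∃ P : MvPolynomial (TrigVars r l) ℤ,
      ∀ d, f d = MvPolynomial.aeval (fun v => generator N r l v d) P := by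
  obtain ⟨P, rfl⟩ := hf
  refine ⟨P, fun d => ?_⟩
  exact DFunLike.congr_fun (MvPolynomial.comp_aeval (generator N r l)
    (Pi.evalAlgHom ℤ (fun d : LaxSolution N r => d.A) d)) P

/-- The traces of `M` and of all `M * F^{ab}` are polynomials in the generators. -/
def HasPolyTraces (l : ℕ) (M : ∀ d : LaxSolution N r, Matrix (Fin N) (Fin N) d.A) : Prop :=
  (fun d => (M d).trace) ∈ polys N r l ∧
    ∀ a b, (fun d => (M d * Fab d.ξ d.η a b).trace) ∈ polys N r l

variable {l : ℕ}

theorem HasPolyTraces.add {M M' : ∀ d : LaxSolution N r, Matrix (Fin N) (Fin N) d.A}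
    (h : HasPolyTraces l M) (h' : HasPolyTraces l M') :
    HasPolyTraces l fun d => M d + M' d := by
  simp only [HasPolyTraces, add_mul, trace_add]
  exact ⟨add_mem h.1 h'.1, fun a b => add_mem (h.2 a b) (h'.2 a b)⟩

theorem HasPolyTraces.smul {M : ∀ d : LaxSolution N r, Matrix (Fin N) (Fin N) d.A}
    {c : ∀ d : LaxSolution N r, d.A} (hc : c ∈ polys N r l) (h : HasPolyTraces l M) :
    HasPolyTraces l fun d => c d • M d := by
  simp only [HasPolyTraces, Matrix.smul_mul, trace_smul, smul_eq_mul]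
  exact ⟨mul_mem hc h.1, fun a b => mul_mem hc (h.2 a b)⟩

theorem two_mem_polys : (fun d : LaxSolution N r => (2 : d.A)) ∈ polys N r l :=
  ofNat_mem (polys N r l) 2

theorem two_mul_α_mem_polys : (fun d : LaxSolution N r => 2 * d.α) ∈ polys N r l :=
  mul_mem two_mem_polys (generator_mem_polys (Sum.inl ()))

theorem hasPolyTraces_mul_Fmat_mul {n : ℕ}
    (ih : ∀ w : List (Fin 3), w.length < n → HasPolyTraces (N := N) (r := r) l fun d => d.word w)
    (u v : List (Fin 3)) (h : u.length + v.length < n) :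
    HasPolyTraces (N := N) (r := r) l fun d => d.word u * Fmat d.ξ d.η * d.word v := by
  constructor
  · have key : ∀ d : LaxSolution N r, (d.word u * Fmat d.ξ d.η * d.word v).trace =
        ∑ c, (d.word (v ++ u) * Fab d.ξ d.η c c).trace := fun d => by
      rw [trace_mul_comm, ← Matrix.mul_assoc, ← word_append, Fmat, Finset.mul_sum, trace_sum]
    simp only [key]
    have := sum_mem (S := polys N r l) (t := Finset.univ) fun c _ =>
      (ih (v ++ u) (by simp only [List.length_append]; omega)).2 c c
    convert this using 1
    ext d
    simp
  · intro a b
    have key : ∀ d : LaxSolution N r,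
        (d.word u * Fmat d.ξ d.η * d.word v * Fab d.ξ d.η a b).trace =
        ∑ c, (d.word v * Fab d.ξ d.η c b).trace * (d.word u * Fab d.ξ d.η a c).trace :=
      fun d => by
        simp only [Fmat, Finset.mul_sum, Finset.sum_mul, trace_sum, trace_mul_Fab_mul_mul_Fab]
    simp only [key]
    have := sum_mem (S := polys N r l) (t := Finset.univ) fun c _ =>
      mul_mem ((ih v (by omega)).2 c b) ((ih u (by omega)).2 a c)
    convert this using 1
    ext d
    simp

theorem hasPolyTraces_swap {n : ℕ}
    (ih : ∀ w : List (Fin 3), w.length < n → HasPolyTraces (N := N) (r := r) l fun d => d.word w)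
    (k : Fin 3) (u v : List (Fin 3)) (hn : u.length + v.length + 2 = n)
    (h : HasPolyTraces (N := N) (r := r) l fun d => d.word (u ++ 0 :: k :: v)) :
    HasPolyTraces (N := N) (r := r) l fun d => d.word (u ++ k :: 0 :: v) := by
  have hk := ih (u ++ k :: v) (by simp only [List.length_append, List.length_cons]; omega)
  by_cases h0 : k = 0
  · subst h0; exact h
  by_cases h1 : k = 1
  · subst h1
    have hF := hasPolyTraces_mul_Fmat_mul ih u (1 :: v) (by simp only [List.length_cons]; omega)
    convert (h.add (hF.smul (neg_mem two_mem_polys))).add (hk.smul two_mul_α_mem_polys) using 2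
      with d
    have := congrArg (fun M => d.word u * M * d.word v) d.K_mul_L
    simpa [word_append, word_cons, letter, mul_add, add_mul, Matrix.mul_assoc] using this
  · have hF := hasPolyTraces_mul_Fmat_mul ih (u ++ [k]) v
      (by simp only [List.length_append, List.length_singleton]; omega)
    convert (h.add (hF.smul two_mem_polys)).add (hk.smul (neg_mem two_mul_α_mem_polys)) using 2
      with d
    have := congrArg (fun M => d.word u * M * d.word v) d.inv_K_mul_L
    simpa [word_append, word, letter, h0, h1, mul_add, add_mul, Matrix.mul_assoc] using this

theorem hasPolyTraces_move {n : ℕ}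
    (ih : ∀ w : List (Fin 3), w.length < n → HasPolyTraces (N := N) (r := r) l fun d => d.word w)
    (t u v : List (Fin 3)) (hn : t.length + u.length + v.length + 1 = n)
    (h : HasPolyTraces (N := N) (r := r) l fun d => d.word (t ++ 0 :: (u ++ v))) :
    HasPolyTraces (N := N) (r := r) l fun d => d.word (t ++ (u ++ 0 :: v)) := by
  induction u generalizing t with
  | nil => exact h
  | cons k u ihu =>
    simp only [List.length_cons] at hn
    have := ihu (t ++ [k]) (by simp only [List.length_append, List.length_singleton]; omega)
      (by
        simpa using hasPolyTraces_swap ih k t (u ++ v)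
          (by simp only [List.length_append]; omega) h)
    simpa using this

theorem hasPolyTraces_normal_append {n : ℕ} (hl : n ≤ l)
    (ih : ∀ w : List (Fin 3), w.length < n → HasPolyTraces (N := N) (r := r) l fun d => d.word w)
    (w : List (Fin 3)) (p : ℕ) (u : List (Fin 3)) (hu : 0 ∉ u)
    (hn : p + u.length + w.length = n) :
    HasPolyTraces (N := N) (r := r) l fun d => d.word (List.replicate p 0 ++ (u ++ w)) := by
  induction w generalizing p u with
  | nil =>
    obtain ⟨q, hq, h⟩ := exists_word_eq_zpow (N := N) (r := r) u hu
    simp only [List.length_nil] at hn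
    simp only [List.append_nil, word_append, word_replicate_zero, h]
    have hpq : p ≤ l ∧ q.natAbs ≤ l := by omega
    exact ⟨generator_mem_polys (Sum.inr (Sum.inl ⟨(p, q), hpq⟩)),
      fun a b => generator_mem_polys (Sum.inr (Sum.inr ((a, b), ⟨(p, q), hpq⟩)))⟩
  | cons k w ihw =>
    simp only [List.length_cons] at hn
    by_cases h0 : k = 0
    · subst h0
      apply hasPolyTraces_move ih _ u w (by simp only [List.length_replicate]; omega)
      have := ihw (p + 1) u hu (by omega)
      rw [List.replicate_succ'] at this
      simpa using this
    · have := ihw p (u ++ [k]) (by simp [hu, Ne.symm h0])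
        (by simp only [List.length_append, List.length_singleton]; omega)
      simpa using this

theorem hasPolyTraces_word (w : List (Fin 3)) (hw : w.length ≤ l) :
    HasPolyTraces (N := N) (r := r) l fun d => d.word w := by
  induction hn : w.length using Nat.strong_induction_on generalizing w with
  | _ n ih =>
    subst hn
    simpa using hasPolyTraces_normal_append hw
      (fun w' h => ih _ h w' (by omega) rfl) w 0 [] (by simp) (by simp)

end LaxSolution

theorem statement16 (l : ℕ) (w : Fin l → Fin 3) (N r : ℕ) (hN : 1 ≤ N) (hr : 1 ≤ r)
    (a b : Fin r) :
    ∃ P Pab : MvPolynomial (TrigVars r l) ℤ,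
      ∀ (A : Type) (_ : CommRing A) (α : A) (ξ η : Fin N → Fin r → A)
        (K L : Matrix (Fin N) (Fin N) A), IsUnit K →
        L * K - K * L = (2 : A) • (Fmat ξ η * K) - (2 * α) • K →
        ((List.ofFn fun k =>
            if w k = 0 then L else if w k = 1 then K else K⁻¹).prod).trace =
          MvPolynomial.aeval
            (fun v : TrigVars r l =>
              match v with
              | Sum.inl _ => α
              | Sum.inr (Sum.inl pq) => (L ^ pq.1.1 * K ^ pq.1.2).trace
              | Sum.inr (Sum.inr cdpq) =>
                  (L ^ cdpq.2.1.1 * K ^ cdpq.2.1.2 *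
                    Fab ξ η cdpq.1.1 cdpq.1.2).trace) P ∧
        ((List.ofFn fun k =>
            if w k = 0 then L else if w k = 1 then K else K⁻¹).prod *
              Fab ξ η a b).trace =
          MvPolynomial.aeval
            (fun v : TrigVars r l =>
              match v with
              | Sum.inl _ => α
              | Sum.inr (Sum.inl pq) => (L ^ pq.1.1 * K ^ pq.1.2).trace
              | Sum.inr (Sum.inr cdpq) =>
                  (L ^ cdpq.2.1.1 * K ^ cdpq.2.1.2 *
                    Fab ξ η cdpq.1.1 cdpq.1.2).trace) Pab := by
  obtain ⟨h, hF⟩ := LaxSolution.hasPolyTraces_word (N := N) (r := r) (List.ofFn w)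
    (List.length_ofFn (f := w)).le
  obtain ⟨P, hP⟩ := LaxSolution.exists_of_mem_polys h
  obtain ⟨Q, hQ⟩ := LaxSolution.exists_of_mem_polys (hF a b)
  refine ⟨P, Q, fun A _ α ξ η K L hK hLK => ?_⟩
  let d : LaxSolution N r := ⟨A, α, ξ, η, K, L, hK, hLK⟩
  have hw : d.word (List.ofFn w) =
      (List.ofFn fun k => if w k = 0 then L else if w k = 1 then K else K⁻¹).prod := by
    rw [LaxSolution.word, List.map_ofFn]
    rfl
  rw [← hw]
  constructor
  · convert hP d using 3
    ext v
    rcases v with _ | _ | _ <;> rfl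
  · convert hQ d using 3
    ext v
    rcases v with _ | _ | _ <;> rfl
end
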